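/- For every d ≥ 2 there exist d distinct lines in P^2, pairwise meeting in binom(d,2) distinct points (no three lines concurrent), such that the set C_d of these binom(d,2) intersection points satisfies: (1) H_{C_d}(t) = min{ binom(t+2,2), binom(d,2) } for every t ≥ 0 (so C_d has generic Hilbert function), and (2) H_{2C_d}(t) = binom(t+2,2) if t ≤ d−1, H_{2C_d}(t) = binom(d+1,2) + (t+1−d)d if d ≤ t ≤ 2d−3, and H_{2C_d}(t) = 3·binom(d,2) if t ≥ 2d−2. -/

import Mathlib

open MvPolynomial

/-- The vanishing (prime) ideal of a point of ℙ²: the ideal generated by the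
linear forms vanishing at the point. -/
noncomputable def pointIdeal (k : Type) [Field k] (P : Projectivization k (Fin 3 → k)) :
    Ideal (MvPolynomial (Fin 3) k) :=
  Ideal.span {f : MvPolynomial (Fin 3) k | f.IsHomogeneous 1 ∧ eval P.rep f = 0}

/-- The Hilbert function of R/I: H(t) = dim_k R_t − dim_k I_t. -/
noncomputable def hilbertFunction (k : Type) [Field k]
    (I : Ideal (MvPolynomial (Fin 3) k)) (t : ℕ) : ℕ :=
  Module.finrank k ↥(homogeneousSubmodule (Fin 3) k t) -
    Module.finrank k ↥(Submodule.restrictScalars k I ⊓ homogeneousSubmodule (Fin 3) k t)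

/-- The defining ideal `I_X` of a finite set of points. -/
noncomputable def idealOfPoints (k : Type) [Field k] {s : ℕ}
    (P : Fin s → Projectivization k (Fin 3 → k)) : Ideal (MvPolynomial (Fin 3) k) :=
  ⨅ i, pointIdeal k (P i)

/-- The defining ideal `I_{2X}` of the double point scheme supported on a finite set of points. -/
noncomputable def doubleIdealOfPoints (k : Type) [Field k] {s : ℕ}
    (P : Fin s → Projectivization k (Fin 3 → k)) : Ideal (MvPolynomial (Fin 3) k) :=
  ⨅ i, (pointIdeal k (P i)) ^ 2

/-- `X` has generic Hilbert function: `H_X(t) = min {s, binom(t+2,2)}` for all `t`. -/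
def HasGenericHilbertFunction (k : Type) [Field k] {s : ℕ}
    (P : Fin s → Projectivization k (Fin 3 → k)) : Prop :=
  ∀ t : ℕ, hilbertFunction k (idealOfPoints k P) t = min s (Nat.choose (t + 2) 2)


section StarConfiguration

variable {k : Type} [Field k]

/-- A homogeneous polynomial of degree `n` scales by `r ^ n`. -/
lemma MvPolynomial.IsHomogeneous.aeval_mul_left {σ R S : Type*} [CommSemiring R] [CommSemiring S]
    [Algebra R S] {f : MvPolynomial σ R} {n : ℕ} (hf : f.IsHomogeneous n) (r : S) (w : σ → S) :
    MvPolynomial.aeval (fun i => r * w i) f = r ^ n * MvPolynomial.aeval w f := by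
  simp only [aeval_def, eval₂_eq, Finset.mul_sum, mul_pow, Finset.prod_mul_distrib,
    Finset.prod_pow_eq_pow_sum]
  refine Finset.sum_congr rfl fun m hm => ?_
  rw [hf.degree_eq_sum_deg_support hm]
  ring

lemma MvPolynomial.IsHomogeneous.natDegree_aeval_le {σ : Type*} {R : Type*} [CommSemiring R]
    {f : MvPolynomial σ R} {n : ℕ} (hf : f.IsHomogeneous n) {w : σ → Polynomial R}
    (hw : ∀ i, (w i).natDegree ≤ 1) : (MvPolynomial.aeval w f).natDegree ≤ n := by
  rw [aeval_def, eval₂_eq]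
  refine Polynomial.natDegree_sum_le_of_forall_le _ _ fun m hm => ?_
  refine (Polynomial.natDegree_C_mul_le _ _).trans ((Polynomial.natDegree_prod_le _ _).trans ?_)
  rw [hf.degree_eq_sum_deg_support hm]
  refine Finset.sum_le_sum fun i _ => Polynomial.natDegree_pow_le.trans ?_
  simpa using Nat.mul_le_mul_left (m i) (hw i)

attribute [local instance] MvPolynomial.gradedAlgebra in
/-- A homogeneous multiple of a homogeneous polynomial `F` has a homogeneous cofactor. -/
lemma MvPolynomial.IsHomogeneous.exists_eq_mul_of_dvd {σ R : Type*} [CommSemiring R]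
    {F f : MvPolynomial σ R} {d t : ℕ} (hF : F.IsHomogeneous d) (hf : f.IsHomogeneous t)
    (h : F ∣ f) (hdt : d ≤ t) : ∃ g : MvPolynomial σ R, g.IsHomogeneous (t - d) ∧ f = F * g := by
  obtain ⟨g, rfl⟩ := h
  refine ⟨DirectSum.decompose (homogeneousSubmodule σ R) g (t - d),
    (DirectSum.decompose (homogeneousSubmodule σ R) g (t - d)).2, ?_⟩
  rw [← DirectSum.coe_decompose_mul_add_of_left_mem (homogeneousSubmodule σ R) (i := d) hF,
    Nat.add_sub_cancel' hdt, DirectSum.decompose_of_mem_same _ hf]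

lemma MvPolynomial.IsHomogeneous.eq_zero_of_dvd {σ R : Type*} [CommRing R] [IsDomain R]
    {F f : MvPolynomial σ R} {d t : ℕ} (hF : F.IsHomogeneous d) (hF0 : F ≠ 0)
    (hf : f.IsHomogeneous t) (h : F ∣ f) (htd : t < d) : f = 0 := by
  by_contra hf0
  obtain ⟨g, rfl⟩ := h
  have h1 := totalDegree_mul_of_isDomain hF0 (right_ne_zero_of_mul hf0)
  rw [hf.totalDegree hf0, hF.totalDegree hF0] at h1
  lia

lemma finrank_homogeneousSubmodule (t : ℕ) :
    Module.finrank k (homogeneousSubmodule (Fin 3) k t) = (t + 2).choose 2 := by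
  have hset : {m : Fin 3 →₀ ℕ | m.degree = t} =
      ↑((Finset.univ : Finset (Fin 3)).finsuppAntidiag t) := by
    ext m
    simp [Finsupp.degree_eq_sum]
  rw [homogeneousSubmodule_eq_finsupp_supported, hset,
    (AddMonoidAlgebra.supportedEquivFinsupp (R := k) (S := k) _).finrank_eq,
    Module.finrank_finsupp_self]
  simp only [SetLike.coe_sort_coe, Fintype.card_coe, Finset.card_finsuppAntidiag_nat_eq_choose,
    Finset.card_univ, Fintype.card_fin]
  rw [show 3 + t - 1 = t + 2 by lia, Nat.choose_symm_add]

instance finite_homogeneousSubmodule (t : ℕ) :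
    Module.Finite k (homogeneousSubmodule (Fin 3) k t) :=
  Module.Finite.iff_fg.mpr (homogeneousSubmodule_fg _ _ t)

lemma hilbertFunction_eq_finrank_map {M : Type*} [AddCommGroup M] [Module k M]
    (I : Ideal (MvPolynomial (Fin 3) k)) (t : ℕ) (Φ : MvPolynomial (Fin 3) k →ₗ[k] M)
    (h : ∀ f : MvPolynomial (Fin 3) k, f.IsHomogeneous t → (f ∈ I ↔ Φ f = 0)) :
    hilbertFunction k I t = Module.finrank k ((homogeneousSubmodule (Fin 3) k t).map Φ) := by
  set S := homogeneousSubmodule (Fin 3) k t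
  have hker : LinearMap.ker (Φ.domRestrict S) =
      (Submodule.restrictScalars k I ⊓ S).comap S.subtype := by
    ext ⟨f, hf⟩
    simpa [hf] using (h f hf).symm
  have hrank := (Φ.domRestrict S).finrank_range_add_finrank_ker
  rw [LinearMap.range_domRestrict, hker,
    (Submodule.comapSubtypeEquivOfLe inf_le_right).finrank_eq] at hrank
  rw [hilbertFunction, ← hrank, Nat.add_sub_cancel]

/-- The line dual to the point `(1 : a : a ^ 2)` of a conic. -/
noncomputable def starLine (a : k) : MvPolynomial (Fin 3) k :=
  X 0 + C a * X 1 + C (a ^ 2) * X 2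

/-- Homogeneous coordinates of the common point of `starLine a` and `starLine b`. -/
def starVec (a b : k) : Fin 3 → k := ![a * b, -(a + b), 1]

lemma starVec_ne_zero (a b : k) : starVec a b ≠ 0 := fun h => by
  simpa [starVec] using congrFun h 2

/-- The common point of `starLine a` and `starLine b`. -/
def starPoint (a b : k) : Projectivization k (Fin 3 → k) :=
  Projectivization.mk k (starVec a b) (starVec_ne_zero a b)

lemma starVec_comm (a b : k) : starVec a b = starVec b a := by
  simp [starVec, mul_comm, add_comm]

lemma starPoint_comm (a b : k) : starPoint a b = starPoint b a := by
  simp [starPoint, starVec_comm]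

lemma starLine_isHomogeneous (a : k) : (starLine a).IsHomogeneous 1 :=
  ((isHomogeneous_X _ _).add (isHomogeneous_C_mul_X _ _)).add (isHomogeneous_C_mul_X _ _)

@[simp]
lemma eval_starVec_starLine (a b c : k) :
    eval (starVec a b) (starLine c) = (c - a) * (c - b) := by
  simp [starVec, starLine]
  ring

lemma eval_rep_starPoint_eq_zero_iff {f : MvPolynomial (Fin 3) k} {n : ℕ}
    (hf : f.IsHomogeneous n) (a b : k) :
    eval (starPoint a b).rep f = 0 ↔ eval (starVec a b) f = 0 := by
  obtain ⟨c, hc⟩ := Projectivization.exists_smul_eq_mk_rep k (starVec a b) (starVec_ne_zero a b)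
  have h := hf.aeval_mul_left (c : k) (starVec a b)
  simp only [aeval_eq_eval] at h
  rw [starPoint, ← hc]
  change eval (fun i => (c : k) * starVec a b i) f = 0 ↔ _
  rw [h]
  simp

lemma starLine_ne_zero (a : k) : starLine a ≠ 0 := fun h => by
  simpa [starLine] using congrArg (eval ![1, 0, 0]) h

/-- The substitution `x = -(a y + a ^ 2 z)` eliminating `x` on `starLine a`. -/
noncomputable def elimX (a : k) : MvPolynomial (Fin 3) k →ₐ[k] MvPolynomial (Fin 3) k :=
  aeval ![-(C a * X 1 + C (a ^ 2) * X 2), X 1, X 2]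

lemma starLine_dvd_sub_elimX (a : k) (f : MvPolynomial (Fin 3) k) :
    starLine a ∣ f - elimX a f := by
  rw [← Ideal.mem_span_singleton, ← Ideal.Quotient.eq]
  change Ideal.Quotient.mkₐ k _ f = ((Ideal.Quotient.mkₐ k _).comp (elimX a)) f
  congr 1
  ext i
  simp only [AlgHom.comp_apply, Ideal.Quotient.mkₐ_eq_mk, Ideal.Quotient.eq,
    Ideal.mem_span_singleton]
  fin_cases i
  · exact Eq.dvd (by simp [elimX, starLine]; ring)
  · simp [elimX]
  · simp [elimX]

lemma starLine_dvd_iff (a : k) (f : MvPolynomial (Fin 3) k) :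
    starLine a ∣ f ↔ elimX a f = 0 := by
  refine ⟨?_, fun h => by simpa [h] using starLine_dvd_sub_elimX a f⟩
  rintro ⟨g, rfl⟩
  have : elimX a (starLine a) = 0 := by
    simp [elimX, starLine]
  simp [this]

lemma starLine_prime (a : k) : Prime (starLine a) := by
  refine ⟨starLine_ne_zero a, fun h => ?_, fun f g h => ?_⟩
  · simpa using (starLine_dvd_iff a 1).mp h.dvd
  · simpa [starLine_dvd_iff] using h

lemma starLine_not_dvd {a b : k} (hab : a ≠ b) : ¬ starLine a ∣ starLine b := fun h => by
  have h1 := map_dvd (eval (starVec a a)) h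
  simp [sub_eq_zero, hab.symm] at h1

lemma prod_starLine_dvd {ι : Type*} {a : ι → k} (ha : Function.Injective a) (s : Finset ι)
    {f : MvPolynomial (Fin 3) k} (h : ∀ i ∈ s, starLine (a i) ∣ f) :
    ∏ i ∈ s, starLine (a i) ∣ f := by
  classical
  induction s using Finset.induction_on with
  | empty => simp
  | insert i s his ih =>
    obtain ⟨g, rfl⟩ := ih fun j hj => h j (Finset.mem_insert_of_mem hj)
    rw [Finset.prod_insert his, mul_comm]
    refine mul_dvd_mul_left _ (((starLine_prime (a i)).dvd_or_dvd
      (h i (Finset.mem_insert_self i s))).resolve_left fun hd => ?_)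
    obtain ⟨j, hj, hd⟩ := ((starLine_prime (a i)).dvd_finsetProd_iff _).mp hd
    exact starLine_not_dvd (ha.ne (ne_of_mem_of_not_mem hj his).symm) hd

lemma prod_starLine_isHomogeneous {ι : Type*} (a : ι → k) (s : Finset ι) :
    (∏ i ∈ s, starLine (a i)).IsHomogeneous s.card := by
  simpa using IsHomogeneous.prod s _ _ fun i _ => starLine_isHomogeneous (a i)

/-- Restriction to `starLine a`, parametrized by `s ↦ starVec a s`. -/
noncomputable def restrictLine (a : k) : MvPolynomial (Fin 3) k →ₐ[k] Polynomial k :=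
  aeval ![Polynomial.C a * Polynomial.X, -(Polynomial.C a + Polynomial.X), 1]

lemma eval_restrictLine (a s : k) (f : MvPolynomial (Fin 3) k) :
    (restrictLine a f).eval s = eval (starVec a s) f := by
  rw [← Polynomial.coe_aeval_eq_eval, ← AlgHom.comp_apply, ← aeval_eq_eval]
  congr 1
  ext i
  fin_cases i <;> simp [restrictLine, starVec]

lemma natDegree_restrictLine_le (a : k) {f : MvPolynomial (Fin 3) k} {t : ℕ}
    (hf : f.IsHomogeneous t) : (restrictLine a f).natDegree ≤ t := by
  refine hf.natDegree_aeval_le fun i => ?_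
  fin_cases i
  · simpa using Polynomial.natDegree_C_mul_le a Polynomial.X |>.trans Polynomial.natDegree_X_le
  · simp only [Fin.mk_one, Matrix.cons_val_one, Matrix.cons_val_zero, Polynomial.natDegree_neg]
    compute_degree
  · simp

lemma eval_eq_zero_of_mem_pointIdeal {a b : k} {f : MvPolynomial (Fin 3) k}
    (hf : f ∈ pointIdeal k (starPoint a b)) : eval (starVec a b) f = 0 := by
  have h : pointIdeal k (starPoint a b) ≤ RingHom.ker (eval (starVec a b)) :=
    Ideal.span_le.mpr fun g hg => (eval_rep_starPoint_eq_zero_iff hg.1 a b).mp hg.2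
  exact h hf

lemma pow_dvd_restrictLine {a b : k} {m : ℕ} {f : MvPolynomial (Fin 3) k}
    (hf : f ∈ pointIdeal k (starPoint a b) ^ m) :
    (Polynomial.X - Polynomial.C b) ^ m ∣ restrictLine a f := by
  have h : (pointIdeal k (starPoint a b)).map (restrictLine a) ≤
      Ideal.span {Polynomial.X - Polynomial.C b} := by
    refine Ideal.map_le_iff_le_comap.mpr fun g hg => ?_
    rw [Ideal.mem_comap, Ideal.mem_span_singleton, Polynomial.dvd_iff_isRoot,
      Polynomial.IsRoot.def, eval_restrictLine]
    exact eval_eq_zero_of_mem_pointIdeal hg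
  have h1 := Ideal.mem_map_of_mem (restrictLine a) hf
  rw [Ideal.map_pow] at h1
  have h2 := Ideal.pow_right_mono h m h1
  rwa [Ideal.span_singleton_pow, Ideal.mem_span_singleton] at h2

lemma starLine_dvd_of_restrictLine_eq_zero [Infinite k] {a : k} {f : MvPolynomial (Fin 3) k}
    {t : ℕ} (hf : f.IsHomogeneous t) (h : restrictLine a f = 0) : starLine a ∣ f := by
  rw [starLine_dvd_iff]
  suffices X 2 * elimX a f = 0 from (mul_eq_zero.mp this).resolve_left (X_ne_zero 2)
  refine MvPolynomial.funext fun w => ?_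
  by_cases hw : w 2 = 0
  · simp [hw]
  have h1 : eval w (elimX a f) =
      aeval (fun i => w 2 * starVec a (-(w 1 / w 2) - a) i) f := by
    rw [← aeval_eq_eval, ← AlgHom.comp_apply]
    congr 1
    ext i
    fin_cases i
    · simp [elimX, starVec]
      field_simp
      ring
    · simp [elimX, starVec]
      field_simp
    · simp [elimX, starVec]
  rw [map_mul, h1, hf.aeval_mul_left, aeval_eq_eval, ← eval_restrictLine, h]
  simp

/-- Taylor expansion to first order at a point `v` of the chart `z = 1`. -/
lemma sub_taylor_mem_sq {v : Fin 3 → k} (hv : v 2 = 1) {I : Ideal (MvPolynomial (Fin 3) k)}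
    (h0 : X 0 - C (v 0) * X 2 ∈ I) (h1 : X 1 - C (v 1) * X 2 ∈ I) (f : MvPolynomial (Fin 3) k) :
    f - (aeval (fun i => X 2 * C (v i)) f +
      (X 0 - C (v 0) * X 2) * aeval (fun i => X 2 * C (v i)) (pderiv 0 f) +
      (X 1 - C (v 1) * X 2) * aeval (fun i => X 2 * C (v i)) (pderiv 1 f)) ∈ I ^ 2 := by
  have h00 := Ideal.mul_mem_mul h0 h0
  have h01 := Ideal.mul_mem_mul h0 h1
  have h11 := Ideal.mul_mem_mul h1 h1
  rw [← sq] at h00 h01 h11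
  induction f using MvPolynomial.induction_on with
  | C c => simp
  | add f g hf hg =>
    convert add_mem hf hg using 1
    simp only [map_add]
    ring
  | mul_X f i hf =>
    fin_cases i
    · convert add_mem (Ideal.mul_mem_left _ (X 0) hf) (add_mem
        (Ideal.mul_mem_left _ (aeval (fun i => X 2 * C (v i)) (pderiv 0 f)) h00)
        (Ideal.mul_mem_left _ (aeval (fun i => X 2 * C (v i)) (pderiv 1 f)) h01)) using 1
      simp [Derivation.leibniz, pderiv_X]
      ring
    · convert add_mem (Ideal.mul_mem_left _ (X 1) hf) (add_mem
        (Ideal.mul_mem_left _ (aeval (fun i => X 2 * C (v i)) (pderiv 0 f)) h01)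
        (Ideal.mul_mem_left _ (aeval (fun i => X 2 * C (v i)) (pderiv 1 f)) h11)) using 1
      simp [Derivation.leibniz, pderiv_X]
      ring
    · convert Ideal.mul_mem_left _ (X 2) hf using 1
      simp [Derivation.leibniz, pderiv_X, hv]
      ring

/-- Value and first partial derivatives in `x` and `y` at `v`. -/
noncomputable def jet (v : Fin 3 → k) : MvPolynomial (Fin 3) k →ₗ[k] k × k × k :=
  (aeval v).toLinearMap.prod (((aeval v).toLinearMap ∘ₗ (pderiv 0).toLinearMap).prod
    ((aeval v).toLinearMap ∘ₗ (pderiv 1).toLinearMap))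

lemma jet_apply (v : Fin 3 → k) (f : MvPolynomial (Fin 3) k) :
    jet v f = (eval v f, eval v (pderiv 0 f), eval v (pderiv 1 f)) := by
  simp [jet, aeval_eq_eval]

lemma jet_mul (v : Fin 3 → k) (f g : MvPolynomial (Fin 3) k) :
    jet v (f * g) = eval v f • jet v g + eval v g • jet v f - (eval v f * eval v g, 0, 0) := by
  simp [jet_apply, Derivation.leibniz, mul_comm]

lemma X_zero_sub_mem_pointIdeal (a b : k) :
    X 0 - C (starVec a b 0) * X 2 ∈ pointIdeal k (starPoint a b) := by
  have h : (X 0 - C (starVec a b 0) * X 2 : MvPolynomial (Fin 3) k).IsHomogeneous 1 :=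
    (isHomogeneous_X _ _).sub (isHomogeneous_C_mul_X _ _)
  exact Ideal.subset_span ⟨h, (eval_rep_starPoint_eq_zero_iff h a b).mpr (by simp [starVec])⟩

lemma X_one_sub_mem_pointIdeal (a b : k) :
    X 1 - C (starVec a b 1) * X 2 ∈ pointIdeal k (starPoint a b) := by
  have h : (X 1 - C (starVec a b 1) * X 2 : MvPolynomial (Fin 3) k).IsHomogeneous 1 :=
    (isHomogeneous_X _ _).sub (isHomogeneous_C_mul_X _ _)
  exact Ideal.subset_span ⟨h, (eval_rep_starPoint_eq_zero_iff h a b).mpr (by simp [starVec])⟩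

lemma MvPolynomial.IsHomogeneous.aeval_X_mul_C_eq_zero {f : MvPolynomial (Fin 3) k} {n : ℕ}
    (hf : f.IsHomogeneous n) {v : Fin 3 → k} (h : eval v f = 0) :
    MvPolynomial.aeval (fun i => (X 2 * C (v i) : MvPolynomial (Fin 3) k)) f = 0 := by
  have h1 : MvPolynomial.aeval (fun i => (C (v i) : MvPolynomial (Fin 3) k)) f = C (eval v f) := by
    rw [← aeval_eq_eval]
    exact aeval_algebraMap_apply (MvPolynomial (Fin 3) k) v f
  rw [hf.aeval_mul_left, h1, h]
  simp

lemma mem_pointIdeal_iff {a b : k} {f : MvPolynomial (Fin 3) k} {t : ℕ} (hf : f.IsHomogeneous t) :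
    f ∈ pointIdeal k (starPoint a b) ↔ eval (starVec a b) f = 0 := by
  refine ⟨eval_eq_zero_of_mem_pointIdeal, fun h => ?_⟩
  have h0 := X_zero_sub_mem_pointIdeal a b
  have h1 := X_one_sub_mem_pointIdeal a b
  have h2 := Ideal.pow_le_self two_ne_zero (sub_taylor_mem_sq (by simp [starVec]) h0 h1 f)
  rw [hf.aeval_X_mul_C_eq_zero h, zero_add] at h2
  exact (Submodule.sub_mem_iff_left _ (add_mem (Ideal.mul_mem_right _ _ h0)
    (Ideal.mul_mem_right _ _ h1))).mp h2

lemma mem_pointIdeal_sq_iff {a b : k} {f : MvPolynomial (Fin 3) k} {t : ℕ}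
    (hf : f.IsHomogeneous t) :
    f ∈ pointIdeal k (starPoint a b) ^ 2 ↔ jet (starVec a b) f = 0 := by
  constructor
  · intro h
    rw [sq] at h
    refine Submodule.mul_induction_on h (fun g hg g' hg' => ?_) fun g g' hg hg' => ?_
    · simp [jet_mul, eval_eq_zero_of_mem_pointIdeal hg, eval_eq_zero_of_mem_pointIdeal hg']
    · rw [map_add, hg, hg', add_zero]
  · intro h
    simp only [jet_apply, Prod.mk_eq_zero] at h
    have h2 := sub_taylor_mem_sq (by simp [starVec]) (X_zero_sub_mem_pointIdeal a b)
      (X_one_sub_mem_pointIdeal a b) f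
    rw [hf.aeval_X_mul_C_eq_zero h.1, hf.pderiv.aeval_X_mul_C_eq_zero h.2.1,
      hf.pderiv.aeval_X_mul_C_eq_zero h.2.2] at h2
    simpa using h2

lemma map_pi_eq_top {ι V M : Type*} [Fintype ι] [AddCommGroup V] [Module k V] [AddCommGroup M]
    [Module k M] (S : Submodule k V) (Φ : ι → V →ₗ[k] M)
    (h : ∀ p w, ∃ f ∈ S, Φ p f = w ∧ ∀ q, q ≠ p → Φ q f = 0) :
    S.map (LinearMap.pi Φ) = ⊤ := by
  refine eq_top_iff.mpr fun y _ => ?_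
  choose g hgS hgp hgq using fun p => h p (y p)
  refine ⟨∑ p, g p, sum_mem fun p _ => hgS p, funext fun q => ?_⟩
  rw [LinearMap.pi_apply, map_sum, Finset.sum_eq_single q, hgp]
  · exact fun p _ hpq => hgq p q hpq.symm
  · simp

lemma hilbertFunction_eq_card_mul_finrank {ι M : Type*} [Fintype ι] [AddCommGroup M] [Module k M]
    [Module.Finite k M] (I : Ideal (MvPolynomial (Fin 3) k)) (t : ℕ)
    (Φ : ι → MvPolynomial (Fin 3) k →ₗ[k] M)
    (hI : ∀ f : MvPolynomial (Fin 3) k, f.IsHomogeneous t → (f ∈ I ↔ ∀ p, Φ p f = 0))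
    (h : ∀ p w, ∃ f : MvPolynomial (Fin 3) k,
      f.IsHomogeneous t ∧ Φ p f = w ∧ ∀ q, q ≠ p → Φ q f = 0) :
    hilbertFunction k I t = Fintype.card ι * Module.finrank k M := by
  rw [hilbertFunction_eq_finrank_map I t (LinearMap.pi Φ) fun f hf => by
    rw [hI f hf, funext_iff]; rfl, map_pi_eq_top _ Φ h, finrank_top, Module.finrank_pi_fintype]
  simp

lemma hilbertFunction_eq_choose {I : Ideal (MvPolynomial (Fin 3) k)} {t : ℕ}
    (h : ∀ f ∈ I, f.IsHomogeneous t → f = 0) : hilbertFunction k I t = (t + 2).choose 2 := by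
  have hbot : Submodule.restrictScalars k I ⊓ homogeneousSubmodule (Fin 3) k t = ⊥ :=
    (Submodule.eq_bot_iff _).mpr fun f hf => h f hf.1 hf.2
  rw [hilbertFunction, hbot, finrank_bot, finrank_homogeneousSubmodule, Nat.sub_zero]

/-- If the forms of degree `t` in `I` are the multiples of a form `F` of degree `d`, the Hilbert
function at `t` is that of a plane curve of degree `d`. -/
lemma hilbertFunction_of_dvd {I : Ideal (MvPolynomial (Fin 3) k)} {F : MvPolynomial (Fin 3) k}
    {d t : ℕ} (hF : F.IsHomogeneous d) (hF0 : F ≠ 0) (hFI : F ∈ I) (hdt : d ≤ t)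
    (h : ∀ f ∈ I, f.IsHomogeneous t → F ∣ f) :
    hilbertFunction k I t = (t + 2).choose 2 - (t - d + 2).choose 2 := by
  have hmap : Submodule.restrictScalars k I ⊓ homogeneousSubmodule (Fin 3) k t =
      (homogeneousSubmodule (Fin 3) k (t - d)).map (LinearMap.mulLeft k F) := by
    ext f
    constructor
    · rintro ⟨hfI, hf⟩
      obtain ⟨g, hg, rfl⟩ := hF.exists_eq_mul_of_dvd hf (h f hfI hf) hdt
      exact ⟨g, hg, rfl⟩
    · rintro ⟨g, hg, rfl⟩
      refine ⟨I.mul_mem_right g hFI, ?_⟩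
      have := hF.mul hg
      rwa [Nat.add_sub_cancel' hdt] at this
  rw [hilbertFunction, hmap, finrank_homogeneousSubmodule,
    ← (Submodule.equivMapOfInjective (LinearMap.mulLeft k F)
      (mul_right_injective₀ hF0) _).finrank_eq, finrank_homogeneousSubmodule]

/-- Unordered pairs of indices of lines. -/
abbrev StarIndex (d : ℕ) : Type := {p : Fin d × Fin d // p.1 < p.2}

lemma card_starIndex (d : ℕ) : Fintype.card (StarIndex d) = d.choose 2 := by
  have h : ∀ j : Fin d, (Finset.univ.filter fun i : Fin d => i < j).card = j := fun j => by
    rw [Finset.filter_gt_eq_Iio, Fin.card_Iio]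
  rw [Fintype.card_subtype, Finset.card_filter, Fintype.sum_prod_type_right]
  simp_rw [← Finset.card_filter, h]
  rw [Fin.sum_univ_eq_sum_range (fun i => i), Finset.sum_range_id, Nat.choose_two_right]

section Points

variable {d : ℕ} {a : Fin d → k}

lemma exists_mem_pair_notMem {p q : StarIndex d} (hqp : q ≠ p) :
    ∃ l, l ≠ p.1.1 ∧ l ≠ p.1.2 ∧ (l = q.1.1 ∨ l = q.1.2) := by
  obtain ⟨⟨i, j⟩, hij⟩ := p
  obtain ⟨⟨i', j'⟩, hij'⟩ := q
  simp only [ne_eq, Subtype.mk.injEq, Prod.mk.injEq] at *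
  by_contra! h
  have h1 := h i'
  have h2 := h j'
  lia

/-- The product of the lines missing the point indexed by `p`. -/
noncomputable def complementLines (a : Fin d → k) (p : StarIndex d) : MvPolynomial (Fin 3) k :=
  ∏ i ∈ Finset.univ \ {p.1.1, p.1.2}, starLine (a i)

lemma complementLines_isHomogeneous (a : Fin d → k) (p : StarIndex d) :
    (complementLines a p).IsHomogeneous (d - 2) := by
  have h := prod_starLine_isHomogeneous a (Finset.univ \ {p.1.1, p.1.2})
  rwa [Finset.card_sdiff_of_subset (Finset.subset_univ _), Finset.card_pair p.2.ne,
    Finset.card_univ, Fintype.card_fin] at h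

lemma eval_complementLines_ne_zero (ha : Function.Injective a) (p : StarIndex d) :
    eval (starVec (a p.1.1) (a p.1.2)) (complementLines a p) ≠ 0 := by
  rw [complementLines, map_prod, Finset.prod_ne_zero_iff]
  intro i hi
  simp only [Finset.mem_sdiff, Finset.mem_univ, Finset.mem_insert, Finset.mem_singleton, true_and,
    not_or] at hi
  simp [sub_eq_zero, ha.eq_iff, hi]

lemma eval_complementLines_eq_zero {p q : StarIndex d} (hqp : q ≠ p) :
    eval (starVec (a q.1.1) (a q.1.2)) (complementLines a p) = 0 := by
  obtain ⟨l, hl1, hl2, hl⟩ := exists_mem_pair_notMem hqp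
  rw [complementLines, map_prod]
  refine Finset.prod_eq_zero (i := l) (by simp [hl1, hl2]) ?_
  rcases hl with rfl | rfl <;> simp

lemma prod_starLine_mem_sq (a : Fin d → k) (p : StarIndex d) :
    ∏ i, starLine (a i) ∈ pointIdeal k (starPoint (a p.1.1) (a p.1.2)) ^ 2 := by
  have h : ∏ i ∈ {p.1.1, p.1.2}, starLine (a i) ∣ ∏ i, starLine (a i) :=
    Finset.prod_dvd_prod_of_subset _ _ _ (Finset.subset_univ _)
  rw [Finset.prod_pair p.2.ne] at h
  refine Ideal.mem_of_dvd _ h ?_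
  rw [sq]
  refine Ideal.mul_mem_mul ?_ ?_ <;>
    exact (mem_pointIdeal_iff (starLine_isHomogeneous _)).mpr (by simp)

lemma prod_starLine_dvd_of_mem_iInf [Infinite k] (ha : Function.Injective a) {m t : ℕ}
    {f : MvPolynomial (Fin 3) k} (hf : f.IsHomogeneous t)
    (hmem : f ∈ ⨅ p : StarIndex d, pointIdeal k (starPoint (a p.1.1) (a p.1.2)) ^ m)
    (ht : t < m * (d - 1)) : ∏ i, starLine (a i) ∣ f := by
  rw [Submodule.mem_iInf] at hmem
  refine prod_starLine_dvd ha _ fun i _ => starLine_dvd_of_restrictLine_eq_zero hf ?_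
  have hdvd : ∏ j ∈ Finset.univ.erase i, (Polynomial.X - Polynomial.C (a j)) ^ m ∣
      restrictLine (a i) f := by
    refine Finset.prod_dvd_of_coprime (fun j _ l _ hjl =>
      (Polynomial.pairwise_coprime_X_sub_C ha hjl).pow) fun j hj => pow_dvd_restrictLine ?_
    rcases lt_or_gt_of_ne (Finset.ne_of_mem_erase hj) with hji | hij
    · rw [starPoint_comm]
      exact hmem ⟨(j, i), hji⟩
    · exact hmem ⟨(i, j), hij⟩
  refine Polynomial.eq_zero_of_dvd_of_natDegree_lt hdvd
    ((natDegree_restrictLine_le _ hf).trans_lt ?_)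
  rw [Polynomial.natDegree_prod_of_monic _ _ fun j _ => (Polynomial.monic_X_sub_C _).pow m]
  simpa [mul_comm] using ht

lemma exists_isHomogeneous_eval_eq (ha : Function.Injective a) {t : ℕ} (ht : d - 2 ≤ t)
    (p : StarIndex d) (w : k) : ∃ f : MvPolynomial (Fin 3) k, f.IsHomogeneous t ∧
      eval (starVec (a p.1.1) (a p.1.2)) f = w ∧
      ∀ q : StarIndex d, q ≠ p → eval (starVec (a q.1.1) (a q.1.2)) f = 0 := by
  have hp := eval_complementLines_ne_zero ha p
  set e := eval (starVec (a p.1.1) (a p.1.2)) (complementLines a p)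
  refine ⟨C (w / e) * (complementLines a p * X 2 ^ (t - (d - 2))), ?_, ?_, fun q hqp => ?_⟩
  · have h := (complementLines_isHomogeneous a p).mul (isHomogeneous_X_pow (R := k) 2 (t - (d - 2)))
    rw [Nat.add_sub_cancel' ht] at h
    exact h.C_mul _
  · have h2 : starVec (a p.1.1) (a p.1.2) 2 = 1 := rfl
    simp only [map_mul, map_pow, eval_C, eval_X, h2, one_pow, mul_one]
    exact div_mul_cancel₀ w hp
  · simp [eval_complementLines_eq_zero hqp]

lemma exists_isHomogeneous_jet_eq (a b : k) (n : ℕ) (w : k × k × k) :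
    ∃ h : MvPolynomial (Fin 3) k, h.IsHomogeneous (n + 1) ∧ jet (starVec a b) h = w := by
  obtain ⟨α, β, γ⟩ := w
  refine ⟨X 2 ^ n * (C α * X 2 + C β * (X 0 - C (starVec a b 0) * X 2) +
    C γ * (X 1 - C (starVec a b 1) * X 2)), ?_, ?_⟩
  · refine (isHomogeneous_X_pow 2 n).mul (((isHomogeneous_C_mul_X _ _).add ?_).add ?_) <;>
      exact ((isHomogeneous_X _ _).sub (isHomogeneous_C_mul_X _ _)).C_mul _
  · simp [jet_apply, Derivation.leibniz, Derivation.leibniz_pow, pderiv_X, starVec]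

lemma exists_isHomogeneous_jet_eq_of_star (ha : Function.Injective a) {t : ℕ}
    (ht : 2 * (d - 2) + 1 ≤ t) (p : StarIndex d) (w : k × k × k) :
    ∃ f : MvPolynomial (Fin 3) k, f.IsHomogeneous t ∧
      jet (starVec (a p.1.1) (a p.1.2)) f = w ∧
      ∀ q : StarIndex d, q ≠ p → jet (starVec (a q.1.1) (a q.1.2)) f = 0 := by
  have hp := eval_complementLines_ne_zero ha p
  set v := starVec (a p.1.1) (a p.1.2)
  set A := complementLines a p
  set e := eval v A
  obtain ⟨n, rfl⟩ := Nat.exists_eq_add_of_le ht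
  obtain ⟨h, hh, hjet⟩ := exists_isHomogeneous_jet_eq (a p.1.1) (a p.1.2) n
    (w.1 / e ^ 2, (w.2.1 - w.1 / e ^ 2 * eval v (pderiv 0 (A ^ 2))) / e ^ 2,
      (w.2.2 - w.1 / e ^ 2 * eval v (pderiv 1 (A ^ 2))) / e ^ 2)
  refine ⟨A ^ 2 * h, ?_, ?_, fun q hqp => ?_⟩
  · convert ((complementLines_isHomogeneous a p).pow 2).mul hh using 1
    ring
  · change jet v h = _ at hjet
    have hv : eval v h = w.1 / e ^ 2 := by
      simpa [jet_apply] using congrArg Prod.fst hjet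
    rw [jet_mul, hjet, hv, jet_apply, map_pow]
    ext <;> simp only [Prod.smul_mk, Prod.mk_add_mk, Prod.mk_sub_mk, smul_eq_mul] <;>
      field_simp [e, hp] <;> ring
  · have hA : jet (starVec (a q.1.1) (a q.1.2)) (A ^ 2) = 0 := by
      simp [sq, jet_mul, A, eval_complementLines_eq_zero hqp]
    simp [jet_mul, hA, A, eval_complementLines_eq_zero hqp]

lemma hilbertFunction_star [Infinite k] (ha : Function.Injective a) (hd : 2 ≤ d) (t : ℕ) :
    hilbertFunction k (⨅ p : StarIndex d, pointIdeal k (starPoint (a p.1.1) (a p.1.2))) t =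
      min ((t + 2).choose 2) (d.choose 2) := by
  by_cases ht : t + 2 ≤ d
  · rw [min_eq_left (Nat.choose_le_choose 2 ht)]
    refine hilbertFunction_eq_choose fun f hfI hf => ?_
    refine (prod_starLine_isHomogeneous a Finset.univ).eq_zero_of_dvd
      (Finset.prod_ne_zero_iff.mpr fun i _ => starLine_ne_zero (a i)) hf
      (prod_starLine_dvd_of_mem_iInf (m := 1) ha hf (by simpa using hfI) (by lia)) ?_
    rw [Finset.card_univ, Fintype.card_fin]
    lia
  · rw [min_eq_right (Nat.choose_le_choose 2 (by lia)), ← card_starIndex,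
      hilbertFunction_eq_card_mul_finrank _ t
        (fun p : StarIndex d => (aeval (starVec (a p.1.1) (a p.1.2))).toLinearMap),
      Module.finrank_self, mul_one]
    · intro f hf
      simp [Submodule.mem_iInf, mem_pointIdeal_iff hf, aeval_eq_eval]
    · intro p w
      simpa [aeval_eq_eval] using exists_isHomogeneous_eval_eq ha (by lia) p w

lemma choose_two_add_sub (d s : ℕ) :
    (d + s + 2).choose 2 - (s + 2).choose 2 = (d + 1).choose 2 + (s + 1) * d := by
  refine Nat.sub_eq_of_eq_add ?_
  induction s with
  | zero => simp [Nat.choose_succ_succ']; ring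
  | succ s ih =>
    rw [show d + (s + 1) + 2 = d + s + 2 + 1 by ring, show s + 1 + 2 = s + 2 + 1 by ring,
      Nat.choose_succ_succ' _ 1, Nat.choose_succ_succ' (s + 2) 1, ih]
    simp only [Nat.choose_one_right]
    ring

lemma hilbertFunction_double_star [Infinite k] (ha : Function.Injective a) (hd : 2 ≤ d) (t : ℕ) :
    hilbertFunction k (⨅ p : StarIndex d, pointIdeal k (starPoint (a p.1.1) (a p.1.2)) ^ 2) t =
      if t ≤ d - 1 then (t + 2).choose 2
      else if t ≤ 2 * d - 3 then (d + 1).choose 2 + (t + 1 - d) * d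
      else 3 * d.choose 2 := by
  have hF := prod_starLine_isHomogeneous a Finset.univ
  rw [Finset.card_univ, Fintype.card_fin] at hF
  have hF0 : ∏ i, starLine (a i) ≠ 0 :=
    Finset.prod_ne_zero_iff.mpr fun i _ => starLine_ne_zero (a i)
  split_ifs with h1 h2
  · exact hilbertFunction_eq_choose fun f hfI hf => hF.eq_zero_of_dvd hF0 hf
      (prod_starLine_dvd_of_mem_iInf ha hf hfI (by lia)) (by lia)
  · obtain ⟨s, rfl⟩ := Nat.exists_eq_add_of_le (show d ≤ t by lia)
    rw [hilbertFunction_of_dvd hF hF0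
      ((Submodule.mem_iInf _).mpr fun p => prod_starLine_mem_sq a p) (Nat.le_add_right d s)
      fun f hfI hf => prod_starLine_dvd_of_mem_iInf ha hf hfI (by lia), Nat.add_sub_cancel_left,
      choose_two_add_sub, add_assoc, Nat.add_sub_cancel_left]
  · rw [hilbertFunction_eq_card_mul_finrank _ t
      (fun p : StarIndex d => jet (starVec (a p.1.1) (a p.1.2))), card_starIndex]
    · simp [mul_comm]
    · intro f hf
      simp [Submodule.mem_iInf, mem_pointIdeal_sq_iff hf]
    · exact exists_isHomogeneous_jet_eq_of_star ha (by lia)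

end Points

end StarConfiguration

/-- For every d ≥ 2 there exist d distinct lines in ℙ², pairwise meeting in
binom(d,2) distinct points with no three lines concurrent, such that the set C_d of the
intersection points has generic Hilbert function,
H_{C_d}(t) = min {binom(t+2,2), binom(d,2)}, and the double point scheme 2C_d has
H_{2C_d}(t) = binom(t+2,2) for t ≤ d−1, binom(d+1,2) + (t+1−d)d for d ≤ t ≤ 2d−3,
and 3·binom(d,2) for t ≥ 2d−2. -/
theorem statement14 (k : Type) [Field k] [IsAlgClosed k] [CharZero k]
    (d : ℕ) (hd : 2 ≤ d) :
    ∃ (L : Fin d → MvPolynomial (Fin 3) k)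
      (Q : {p : Fin d × Fin d // p.1 < p.2} → Projectivization k (Fin 3 → k)),
      -- the L i are linear forms defining d distinct lines
      (∀ i, (L i).IsHomogeneous 1) ∧ (∀ i, L i ≠ 0) ∧
      (∀ i j, i ≠ j → LinearIndependent k ![L i, L j]) ∧
      -- the Q p are the pairwise intersection points, which are distinct
      Function.Injective Q ∧
      (∀ p : {p : Fin d × Fin d // p.1 < p.2},
        eval (Q p).rep (L p.1.1) = 0 ∧ eval (Q p).rep (L p.1.2) = 0) ∧
      -- no three lines are concurrent: each intersection point lies only on its two lines
      (∀ p : {p : Fin d × Fin d // p.1 < p.2}, ∀ i : Fin d,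
        i ≠ p.1.1 → i ≠ p.1.2 → eval (Q p).rep (L i) ≠ 0) ∧
      -- (1) C_d has the generic Hilbert function of binom(d,2) points
      (∀ t : ℕ, hilbertFunction k (⨅ p, pointIdeal k (Q p)) t =
        min (Nat.choose (t + 2) 2) (Nat.choose d 2)) ∧
      -- (2) the Hilbert function of the double point scheme 2C_d
      (∀ t : ℕ, hilbertFunction k (⨅ p, (pointIdeal k (Q p)) ^ 2) t =
        (if t ≤ d - 1 then Nat.choose (t + 2) 2
          else if t ≤ 2 * d - 3 then Nat.choose (d + 1) 2 + (t + 1 - d) * d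
          else 3 * Nat.choose d 2)) := by
  have ha : Function.Injective fun i : Fin d => (i.val : k) :=
    Nat.cast_injective.comp Fin.val_injective
  set a : Fin d → k := fun i => (i.val : k)
  refine ⟨fun i => starLine (a i), fun p => starPoint (a p.1.1) (a p.1.2),
    fun i => starLine_isHomogeneous _, fun i => starLine_ne_zero _, fun i j hij => ?_,
    fun p q hpq => ?_, fun p => ?_, fun p i h1 h2 => ?_, hilbertFunction_star ha hd,
    hilbertFunction_double_star ha hd⟩
  · refine LinearIndependent.pair_iff.mpr fun s t hst => ?_
    have h1 := congrArg (eval (starVec (a i) (a i))) hst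
    have h2 := congrArg (eval (starVec (a j) (a j))) hst
    simp [smul_eval, sub_eq_zero, ha.eq_iff, hij, hij.symm] at h1 h2
    exact ⟨h2, h1⟩
  · by_contra hne
    obtain ⟨l, hl1, hl2, hl⟩ := exists_mem_pair_notMem hne
    have h := (eval_rep_starPoint_eq_zero_iff (starLine_isHomogeneous (a l)) (a p.1.1)
      (a p.1.2)).mpr (by rcases hl with rfl | rfl <;> simp)
    rw [show starPoint (a p.1.1) (a p.1.2) = starPoint (a q.1.1) (a q.1.2) from hpq,
      eval_rep_starPoint_eq_zero_iff (starLine_isHomogeneous (a l))] at h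
    simp [sub_eq_zero, ha.eq_iff, hl1, hl2] at h
  · constructor <;>
      exact (eval_rep_starPoint_eq_zero_iff (starLine_isHomogeneous _) _ _).mpr (by simp)
  · rw [ne_eq, eval_rep_starPoint_eq_zero_iff (starLine_isHomogeneous _)]
    simp [sub_eq_zero, ha.eq_iff, h1, h2]
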